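/- arXiv:1202.1675 — 2 statements merged into one kernel-verified Lean document; each statement's English description precedes it below -/
import Mathlib

section
/- Let n ≥ 1, α > -n and j ∈ {1,…,n}. There exists a constant C > 0 such that for all x, y ∈ ℝⁿ with x ≠ y, sup_{s>0} (∫_0^∞ Ω_{α,j}(x,y;s,t)² dt/t)^{1/2} ≤ C / |x-y|^{n+1}. -/
open Real MeasureTheory Set

/-- The Mehler (Hermite heat) kernel on ℝⁿ. -/
noncomputable def W (n : ℕ) (s : ℝ) (x y : EuclideanSpace ℝ (Fin n)) : ℝ :=
  (Real.exp (-2 * s) / (Real.pi * (1 - Real.exp (-4 * s)))) ^ ((n : ℝ) / 2) *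
    Real.exp (-(1 / 4) * ((1 + Real.exp (-2 * s)) / (1 - Real.exp (-2 * s)) * ‖x - y‖ ^ 2 +
      (1 - Real.exp (-2 * s)) / (1 + Real.exp (-2 * s)) * ‖x + y‖ ^ 2))

/-- V_{j,s}(x,y) = ∂_{x_j} W_s(x,y). -/
noncomputable def V (n : ℕ) (j : Fin n) (s : ℝ) (x y : EuclideanSpace ℝ (Fin n)) : ℝ :=
  -(1 / 2) * ((1 + Real.exp (-2 * s)) / (1 - Real.exp (-2 * s)) * (x j - y j) +
    (1 - Real.exp (-2 * s)) / (1 + Real.exp (-2 * s)) * (x j + y j)) * W n s x y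

/-- Ω_{α,j}(x,y;s,t) = ∂_{x_j}[t ∂_t P_{t+s}^α(x,y)]. -/
noncomputable def Omj (n : ℕ) (α : ℝ) (j : Fin n) (x y : EuclideanSpace ℝ (Fin n)) (s t : ℝ) : ℝ :=
  t / Real.sqrt (4 * Real.pi) *
    ∫ u in Set.Ioi (0 : ℝ), u ^ (-(3 : ℝ) / 2) * (1 - (t + s) ^ 2 / (2 * u)) *
      Real.exp (-(t + s) ^ 2 / (4 * u)) * Real.exp (-α * u) * V n j u x y

/-- The substitution `u ↦ u⁻¹` in the Gamma integral. -/
lemma integrableOn_and_integral_rpow_mul_exp_neg_div {a B : ℝ} (ha : 0 < a) (hB : 0 < B) :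
    IntegrableOn (fun u : ℝ => u ^ (-(a + 1)) * exp (-(B / u))) (Ioi 0) ∧
      ∫ u in Ioi (0 : ℝ), u ^ (-(a + 1)) * exp (-(B / u)) = (1 / B) ^ a * Gamma a := by
  have hcongr : ∀ u ∈ Ioi (0 : ℝ),
      (|(-1 : ℝ)| * u ^ ((-1 : ℝ) - 1)) •
        (fun y : ℝ => y ^ (a - 1) * exp (-(B * y))) (u ^ (-1 : ℝ)) =
      u ^ (-(a + 1)) * exp (-(B / u)) := by
    intro u hu
    have hu : 0 < u := hu
    simp only [smul_eq_mul, abs_neg, abs_one, one_mul]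
    rw [← rpow_mul hu.le, ← mul_assoc, ← rpow_add hu, rpow_neg_one, div_eq_mul_inv]
    congr 2
    ring
  have hint : IntegrableOn (fun y : ℝ => y ^ (a - 1) * exp (-(B * y))) (Ioi 0) := by
    have h := integrableOn_rpow_mul_exp_neg_mul_rpow (s := a - 1) (p := 1) (b := B)
      (by linarith) one_pos hB
    simpa using h
  constructor
  · rw [← integrableOn_Ioi_comp_rpow_iff _ (by norm_num : (-1 : ℝ) ≠ 0)] at hint
    exact hint.congr_fun hcongr measurableSet_Ioi
  · rw [← integral_rpow_mul_exp_neg_mul_Ioi ha hB,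
      ← integral_comp_rpow_Ioi (fun y : ℝ => y ^ (a - 1) * exp (-(B * y)))
        (by norm_num : (-1 : ℝ) ≠ 0)]
    exact (setIntegral_congr_fun measurableSet_Ioi hcongr).symm

lemma integrableOn_and_integral_mul_inv_sq_add_sq_pow (m : ℕ) {r : ℝ} (hr : 0 < r) :
    IntegrableOn (fun t : ℝ => t * ((t ^ 2 + r ^ 2) ^ (m + 2))⁻¹) (Ioi 0) ∧
      ∫ t in Ioi (0 : ℝ), t * ((t ^ 2 + r ^ 2) ^ (m + 2))⁻¹ =
        ((r ^ (m + 1)) ^ 2)⁻¹ / (2 * (m + 1)) := by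
  have hpos : ∀ t : ℝ, 0 < t ^ 2 + r ^ 2 := fun t => by positivity
  have hderiv : ∀ t ∈ Ici (0 : ℝ),
      HasDerivAt (fun t : ℝ => -(((t ^ 2 + r ^ 2) ^ (m + 1))⁻¹ / (2 * (m + 1))))
        (t * ((t ^ 2 + r ^ 2) ^ (m + 2))⁻¹) t := by
    intro t _
    have h1 : HasDerivAt (fun t : ℝ => (t ^ 2 + r ^ 2) ^ (m + 1))
        ((m + 1 : ℕ) * (t ^ 2 + r ^ 2) ^ m * (2 * t)) t := by
      simpa using (((hasDerivAt_id t).fun_pow 2).add_const (r ^ 2)).fun_pow (m + 1)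
    have h2 := ((h1.inv (pow_ne_zero _ (hpos t).ne')).div_const (2 * ((m : ℝ) + 1))).neg
    refine h2.congr_deriv ?_
    have := (hpos t).ne'
    push_cast
    field_simp
    ring
  have hnonneg : ∀ t ∈ Ioi (0 : ℝ), 0 ≤ t * ((t ^ 2 + r ^ 2) ^ (m + 2))⁻¹ := by
    intro t ht
    have ht : 0 < t := ht
    positivity
  have hlim : Filter.Tendsto (fun t : ℝ => -(((t ^ 2 + r ^ 2) ^ (m + 1))⁻¹ / (2 * (m + 1))))
      Filter.atTop (nhds 0) := by
    have h1 : Filter.Tendsto (fun t : ℝ => (t ^ 2 + r ^ 2) ^ (m + 1))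
        Filter.atTop Filter.atTop :=
      (Filter.tendsto_pow_atTop (Nat.succ_ne_zero m)).comp
        (Filter.tendsto_atTop_add_const_right _ _ (Filter.tendsto_pow_atTop two_ne_zero))
    simpa using (h1.inv_tendsto_atTop.div_const (2 * ((m : ℝ) + 1))).neg
  refine ⟨integrableOn_Ioi_deriv_of_nonneg' hderiv hnonneg hlim, ?_⟩
  rw [integral_Ioi_of_hasDerivAt_of_nonneg' hderiv hnonneg hlim]
  have : ((0 : ℝ) ^ 2 + r ^ 2) ^ (m + 1) = (r ^ (m + 1)) ^ 2 := by ring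
  rw [this]
  ring

lemma add_mul_exp_neg_le_sqrt_mul_exp {c r p : ℝ} (hc : 1 ≤ c) :
    (c * r + c⁻¹ * p) * exp (-(1 / 4) * (c * r ^ 2 + c⁻¹ * p ^ 2)) ≤
      3 * √c * exp (-(c * r ^ 2 / 8)) := by
  have hc0 : 0 < c := by linarith
  obtain ⟨d, hd, rfl⟩ : ∃ d : ℝ, 1 ≤ d ∧ c = d ^ 2 :=
    ⟨√c, by rwa [one_le_sqrt], (sq_sqrt hc0.le).symm⟩
  have hd0 : 0 < d := by linarith
  rw [sqrt_sq hd0.le]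
  set z := d * r with hz
  set w := d⁻¹ * p with hw
  have e1 : d ^ 2 * r = d * z := by rw [hz]; ring
  have e2 : (d ^ 2)⁻¹ * p = d⁻¹ * w := by rw [hw]; ring
  have e3 : d ^ 2 * r ^ 2 = z ^ 2 := by rw [hz]; ring
  have e4 : (d ^ 2)⁻¹ * p ^ 2 = w ^ 2 := by rw [hw, mul_pow, inv_pow]
  have hz2 : z ≤ 2 * exp (z ^ 2 / 8) := by
    nlinarith [add_one_le_exp (z ^ 2 / 8), sq_nonneg (z / 2 - 1)]
  have hw2 : w ≤ exp (w ^ 2 / 4) := by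
    nlinarith [add_one_le_exp (w ^ 2 / 4), sq_nonneg (w / 2 - 1)]
  have hdd : d⁻¹ ≤ d := (inv_le_one_of_one_le₀ hd).trans hd
  have hzE : 1 ≤ exp (z ^ 2 / 8) := one_le_exp (by positivity)
  have hwE : 1 ≤ exp (w ^ 2 / 4) := one_le_exp (by positivity)
  have hsplit : exp (-(z ^ 2 / 8)) =
      exp (z ^ 2 / 8) * exp (w ^ 2 / 4) * exp (-(1 / 4) * (z ^ 2 + w ^ 2)) := by
    rw [← exp_add, ← exp_add]
    congr 1
    ring
  rw [e1, e2, e3, e4, hsplit, ← mul_assoc (3 * d)]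
  refine mul_le_mul_of_nonneg_right ?_ (exp_pos _).le
  have h1 : d * z ≤ 2 * d * (exp (z ^ 2 / 8) * exp (w ^ 2 / 4)) := by
    calc d * z ≤ d * (2 * exp (z ^ 2 / 8)) := by gcongr
      _ = 2 * d * (exp (z ^ 2 / 8) * 1) := by ring
      _ ≤ _ := by gcongr
  have h2 : d⁻¹ * w ≤ d * (exp (z ^ 2 / 8) * exp (w ^ 2 / 4)) := by
    calc d⁻¹ * w ≤ d⁻¹ * exp (w ^ 2 / 4) := by gcongr
      _ ≤ d * exp (w ^ 2 / 4) := by gcongr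
      _ = d * (1 * exp (w ^ 2 / 4)) := by ring
      _ ≤ _ := by gcongr
  linarith

lemma one_sub_exp_neg_bounds {v : ℝ} (hv : 0 < v) :
    v / (1 + v) ≤ 1 - exp (-v) ∧ 1 - exp (-v) ≤ v := by
  constructor
  · have h : exp (-v) ≤ (1 + v)⁻¹ := by
      rw [exp_neg]
      exact inv_anti₀ (by linarith) (by linarith [add_one_le_exp v])
    have : v / (1 + v) = 1 - (1 + v)⁻¹ := by field_simp; ring
    linarith
  · linarith [add_one_le_exp (-v)]

lemma abs_V_le (n : ℕ) (j : Fin n) {u : ℝ} (hu : 0 < u) (x y : EuclideanSpace ℝ (Fin n)) :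
    |V n j u x y| ≤
      3 * (exp (-(n * u)) * ((1 + u) / u) ^ (((n : ℝ) + 1) / 2)) *
        exp (-(‖x - y‖ ^ 2 / 16 / u)) := by
  obtain ⟨h2l, h2u⟩ := one_sub_exp_neg_bounds (v := 2 * u) (by linarith)
  obtain ⟨h4l, -⟩ := one_sub_exp_neg_bounds (v := 4 * u) (by linarith)
  unfold V W
  rw [neg_mul 2 u, neg_mul 4 u]
  set e := exp (-(2 * u)) with he
  have he0 : 0 < e := exp_pos _
  have h2pos : 0 < 1 - e := lt_of_lt_of_le (by positivity) h2l
  have h4pos : 0 < 1 - exp (-(4 * u)) := lt_of_lt_of_le (by positivity) h4l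
  have hinv : (1 - e) / (1 + e) = ((1 + e) / (1 - e))⁻¹ := by rw [inv_div]
  rw [hinv]
  set c := (1 + e) / (1 - e) with hc
  have hc1 : 1 ≤ c := by rw [hc, le_div_iff₀ h2pos]; linarith
  have hcl : 1 / (2 * u) ≤ c := by
    rw [hc, div_le_div_iff₀ (by positivity) h2pos]
    nlinarith
  have hcu : c ≤ 4 * ((1 + u) / u) := by
    rw [div_le_iff₀ (by positivity)] at h2l
    rw [hc, ← mul_div_assoc, div_le_div_iff₀ h2pos hu]
    nlinarith
  have hsqrt : √c ≤ 2 * ((1 + u) / u) ^ (1 / 2 : ℝ) := by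
    rw [← sqrt_eq_rpow]
    refine (sqrt_le_sqrt hcu).trans_eq ?_
    rw [sqrt_mul (by norm_num), show (4 : ℝ) = 2 ^ 2 by norm_num, sqrt_sq (by norm_num)]
  have hpre : (e / (π * (1 - exp (-(4 * u))))) ^ ((n : ℝ) / 2) ≤
      exp (-(n * u)) * ((1 + u) / u) ^ ((n : ℝ) / 2) := by
    have hb : e / (π * (1 - exp (-(4 * u)))) ≤ e * ((1 + u) / u) := by
      rw [div_eq_mul_inv]
      refine mul_le_mul_of_nonneg_left ?_ he0.le
      rw [inv_le_comm₀ (by positivity) (by positivity), inv_div]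
      refine le_trans ?_ (mul_le_mul_of_nonneg_left h4l pi_pos.le)
      calc u / (1 + u) ≤ 1 * (4 * u / (1 + 4 * u)) := by
            rw [one_mul, div_le_div_iff₀ (by positivity) (by positivity)]
            nlinarith
        _ ≤ _ := by
            gcongr
            linarith [pi_gt_three]
    refine (rpow_le_rpow (by positivity) hb (by positivity)).trans_eq ?_
    rw [mul_rpow he0.le (by positivity), he, ← exp_mul]
    congr 2
    ring
  have hcoord : |c * (x j - y j) + c⁻¹ * (x j + y j)| ≤ c * ‖x - y‖ + c⁻¹ * ‖x + y‖ := by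
    have h1 : |x j - y j| ≤ ‖x - y‖ := by
      simpa using PiLp.norm_apply_le (x - y) j
    have h2 : |x j + y j| ≤ ‖x + y‖ := by
      simpa using PiLp.norm_apply_le (x + y) j
    refine (abs_add_le _ _).trans ?_
    rw [abs_mul, abs_mul, abs_of_pos (by linarith : 0 < c),
      abs_of_pos (inv_pos.2 (by linarith : 0 < c))]
    gcongr
  have hexp : exp (-(c * ‖x - y‖ ^ 2 / 8)) ≤ exp (-(‖x - y‖ ^ 2 / 16 / u)) := by
    rw [exp_le_exp, neg_le_neg_iff]
    calc ‖x - y‖ ^ 2 / 16 / u = 1 / (2 * u) * ‖x - y‖ ^ 2 / 8 := by ring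
      _ ≤ _ := by gcongr
  set A := (e / (π * (1 - exp (-(4 * u))))) ^ ((n : ℝ) / 2)
  have hA : 0 ≤ A := by positivity
  set E := exp (-(1 / 4) * (c * ‖x - y‖ ^ 2 + c⁻¹ * ‖x + y‖ ^ 2)) with hE
  have hmain := add_mul_exp_neg_le_sqrt_mul_exp (r := ‖x - y‖) (p := ‖x + y‖) hc1
  rw [← hE] at hmain
  have hE0 : 0 < E := exp_pos _
  rw [abs_mul, abs_mul, abs_of_nonneg (mul_nonneg hA hE0.le)]
  calc |-(1 / 2 : ℝ)| * |c * (x j - y j) + c⁻¹ * (x j + y j)| * (A * E)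
      ≤ 1 / 2 * (c * ‖x - y‖ + c⁻¹ * ‖x + y‖) * (A * E) := by
        rw [abs_neg, abs_of_pos (by norm_num : (0 : ℝ) < 1 / 2)]
        gcongr
    _ = 1 / 2 * A * ((c * ‖x - y‖ + c⁻¹ * ‖x + y‖) * E) := by ring
    _ ≤ 1 / 2 * A * (3 * √c * exp (-(c * ‖x - y‖ ^ 2 / 8))) := by gcongr
    _ ≤ 1 / 2 * (exp (-(n * u)) * ((1 + u) / u) ^ ((n : ℝ) / 2)) *
        (3 * (2 * ((1 + u) / u) ^ (1 / 2 : ℝ)) * exp (-(‖x - y‖ ^ 2 / 16 / u))) := by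
        gcongr
    _ = 3 * (exp (-(n * u)) *
        (((1 + u) / u) ^ ((n : ℝ) / 2) * ((1 + u) / u) ^ (1 / 2 : ℝ))) *
          exp (-(‖x - y‖ ^ 2 / 16 / u)) := by ring
    _ = _ := by
        rw [← rpow_add (by positivity)]
        congr 4
        ring

lemma exists_one_add_rpow_le_exp {δ m : ℝ} (hδ : 0 < δ) (hm : 0 < m) :
    ∃ K > 0, ∀ u : ℝ, 0 < u → (1 + u) ^ m ≤ K * exp (δ * u) := by
  have hε : 0 < δ / m := div_pos hδ hm
  refine ⟨(1 + (δ / m)⁻¹) ^ m, by positivity, fun u hu => ?_⟩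
  have h : 1 + u ≤ (1 + (δ / m)⁻¹) * exp (δ / m * u) := by
    calc 1 + u ≤ (1 + (δ / m)⁻¹) * (δ / m * u + 1) := by
          have h1 : (1 + (δ / m)⁻¹) * (δ / m * u + 1) =
              δ / m * u + (δ / m)⁻¹ + 1 + (δ / m)⁻¹ * (δ / m) * u := by ring
          rw [h1, inv_mul_cancel₀ hε.ne']
          have : 0 < δ / m * u := by positivity
          have : 0 < (δ / m)⁻¹ := by positivity
          linarith
      _ ≤ _ := by
          gcongr
          exact add_one_le_exp _
  refine (rpow_le_rpow (by positivity) h hm.le).trans_eq ?_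
  rw [mul_rpow (by positivity) (exp_pos _).le, ← exp_mul]
  congr 2
  field_simp

lemma exists_exp_mul_abs_V_le (n : ℕ) {α : ℝ} (hα : -(n : ℝ) < α) (j : Fin n) :
    ∃ K > 0, ∀ (u : ℝ) (x y : EuclideanSpace ℝ (Fin n)), 0 < u →
      exp (-α * u) * |V n j u x y| ≤
        K * (u ^ (-(((n : ℝ) + 1) / 2)) * exp (-(‖x - y‖ ^ 2 / 16 / u))) := by
  obtain ⟨K, hK, hKu⟩ := exists_one_add_rpow_le_exp (δ := n + α) (m := ((n : ℝ) + 1) / 2)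
    (by linarith) (by positivity)
  refine ⟨3 * K, by positivity, fun u x y hu => ?_⟩
  calc exp (-α * u) * |V n j u x y|
      ≤ exp (-α * u) * (3 * (exp (-(n * u)) * ((1 + u) / u) ^ (((n : ℝ) + 1) / 2)) *
        exp (-(‖x - y‖ ^ 2 / 16 / u))) := by
        gcongr
        exact abs_V_le n j hu x y
    _ = 3 * (exp (-((n + α) * u)) * (1 + u) ^ (((n : ℝ) + 1) / 2)) *
        (u ^ (-(((n : ℝ) + 1) / 2)) * exp (-(‖x - y‖ ^ 2 / 16 / u))) := by
        have : exp (-((n + α) * u)) = exp (-α * u) * exp (-(n * u)) := by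
          rw [← exp_add]
          congr 1
          ring
        rw [this, div_rpow (by positivity) hu.le, rpow_neg hu.le]
        ring
    _ ≤ 3 * (exp (-((n + α) * u)) * (K * exp ((n + α) * u))) *
        (u ^ (-(((n : ℝ) + 1) / 2)) * exp (-(‖x - y‖ ^ 2 / 16 / u))) := by
        gcongr
        exact hKu u hu
    _ = _ := by
        have : exp (-((n + α) * u)) * (K * exp ((n + α) * u)) = K := by
          rw [mul_left_comm, ← exp_add]
          simp
        rw [this]

lemma abs_one_sub_mul_exp_neg_le {w : ℝ} (hw : 0 ≤ w) :
    |1 - 4 * w| * exp (-(2 * w)) ≤ 4 * exp (-w) := by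
  have h1 : |1 - 4 * w| ≤ 4 * exp w := by
    rw [abs_le]
    constructor <;> linarith [add_one_le_exp w]
  calc |1 - 4 * w| * exp (-(2 * w)) ≤ 4 * exp w * exp (-(2 * w)) := by gcongr
    _ = 4 * exp (-w) := by
      rw [mul_assoc, ← exp_add]
      congr 2
      ring

lemma exists_abs_Omj_le (n : ℕ) {α : ℝ} (hα : -(n : ℝ) < α) (j : Fin n) :
    ∃ K > 0, ∀ (x y : EuclideanSpace ℝ (Fin n)) (s t : ℝ), x ≠ y → 0 < s → 0 < t →
      |Omj n α j x y s t| ≤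
        K * t * (1 / (t ^ 2 + ‖x - y‖ ^ 2)) ^ (((n : ℝ) + 2) / 2) := by
  obtain ⟨K, hK, hKV⟩ := exists_exp_mul_abs_V_le n hα j
  have ha : 0 < ((n : ℝ) + 2) / 2 := by positivity
  have hΓ := Gamma_pos_of_pos ha
  refine ⟨4 * K * (16 ^ (((n : ℝ) + 2) / 2) * Gamma (((n : ℝ) + 2) / 2)) / √(4 * π),
    by positivity, fun x y s t hxy hs ht => ?_⟩
  have hr : 0 < ‖x - y‖ := norm_pos_iff.2 (sub_ne_zero.2 hxy)
  have hB : 0 < (t ^ 2 + ‖x - y‖ ^ 2) / 16 := by positivity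
  obtain ⟨hint, hval⟩ := integrableOn_and_integral_rpow_mul_exp_neg_div ha hB
  have hbound : ∀ u ∈ Ioi (0 : ℝ),
      ‖u ^ (-(3 : ℝ) / 2) * (1 - (t + s) ^ 2 / (2 * u)) *
        exp (-(t + s) ^ 2 / (4 * u)) * exp (-α * u) * V n j u x y‖ ≤
      4 * K * (u ^ (-(((n : ℝ) + 2) / 2 + 1)) *
        exp (-((t ^ 2 + ‖x - y‖ ^ 2) / 16 / u))) := by
    intro u hu
    have hu : 0 < u := hu
    have hw : 0 ≤ (t + s) ^ 2 / (8 * u) := by positivity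
    have hk := abs_one_sub_mul_exp_neg_le hw
    have e1 : 1 - (t + s) ^ 2 / (2 * u) = 1 - 4 * ((t + s) ^ 2 / (8 * u)) := by
      field_simp
      ring
    have e2 : -(t + s) ^ 2 / (4 * u) = -(2 * ((t + s) ^ 2 / (8 * u))) := by
      field_simp
      ring
    have hexp : exp (-((t + s) ^ 2 / (8 * u))) ≤ exp (-(t ^ 2 / 16 / u)) := by
      rw [exp_le_exp, neg_le_neg_iff, div_div]
      gcongr <;> linarith
    rw [e1, e2, norm_eq_abs, abs_mul, abs_mul, abs_mul, abs_mul, abs_exp, abs_exp,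
      abs_of_nonneg (rpow_nonneg hu.le _)]
    calc u ^ (-(3 : ℝ) / 2) * |1 - 4 * ((t + s) ^ 2 / (8 * u))| *
          exp (-(2 * ((t + s) ^ 2 / (8 * u)))) * exp (-α * u) * |V n j u x y|
        = u ^ (-(3 : ℝ) / 2) * (|1 - 4 * ((t + s) ^ 2 / (8 * u))| *
          exp (-(2 * ((t + s) ^ 2 / (8 * u))))) * (exp (-α * u) * |V n j u x y|) := by ring
      _ ≤ u ^ (-(3 : ℝ) / 2) * (4 * exp (-(t ^ 2 / 16 / u))) *
          (K * (u ^ (-(((n : ℝ) + 1) / 2)) * exp (-(‖x - y‖ ^ 2 / 16 / u)))) := by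
          refine mul_le_mul (mul_le_mul_of_nonneg_left (hk.trans ?_) (by positivity))
            (hKV u x y hu) (by positivity) (by positivity)
          gcongr
      _ = 4 * K * ((u ^ (-(3 : ℝ) / 2) * u ^ (-(((n : ℝ) + 1) / 2))) *
          (exp (-(t ^ 2 / 16 / u)) * exp (-(‖x - y‖ ^ 2 / 16 / u)))) := by ring
      _ = _ := by
          rw [← rpow_add hu, ← exp_add]
          congr 3
          all_goals ring
  have hI := norm_integral_le_of_norm_le (hint.const_mul (4 * K))
    ((ae_restrict_iff' measurableSet_Ioi).2 (Filter.Eventually.of_forall hbound))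
  rw [integral_const_mul, hval, norm_eq_abs] at hI
  unfold Omj
  rw [abs_mul, abs_of_nonneg (by positivity : 0 ≤ t / √(4 * π))]
  refine (mul_le_mul_of_nonneg_left hI (by positivity)).trans_eq ?_
  have : 1 / ((t ^ 2 + ‖x - y‖ ^ 2) / 16) = 16 * (1 / (t ^ 2 + ‖x - y‖ ^ 2)) := by
    field_simp
  rw [this, mul_rpow (by norm_num) (by positivity)]
  ring

theorem Omj_H_norm_bound (n : ℕ) (hn : 1 ≤ n) (α : ℝ) (hα : -(n : ℝ) < α) (j : Fin n) :
    ∃ C > (0 : ℝ), ∀ x y : EuclideanSpace ℝ (Fin n), x ≠ y →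
      (⨆ (s : ℝ) (_ : (0 : ℝ) < s),
        Real.sqrt (∫ t in Set.Ioi (0 : ℝ), Omj n α j x y s t ^ 2 / t)) ≤
        C / ‖x - y‖ ^ (n + 1) := by
  obtain ⟨K, hK, hKΩ⟩ := exists_abs_Omj_le n hα j
  refine ⟨K, hK, fun x y hxy => ?_⟩
  have hr : 0 < ‖x - y‖ := norm_pos_iff.2 (sub_ne_zero.2 hxy)
  refine Real.iSup_le (fun s => Real.iSup_le (fun hs => ?_) (by positivity)) (by positivity)
  obtain ⟨hint, hval⟩ := integrableOn_and_integral_mul_inv_sq_add_sq_pow n hr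
  have hle : ∫ t in Ioi (0 : ℝ), Omj n α j x y s t ^ 2 / t ≤
      ∫ t in Ioi (0 : ℝ), K ^ 2 * (t * ((t ^ 2 + ‖x - y‖ ^ 2) ^ (n + 2))⁻¹) := by
    refine integral_mono_of_nonneg ?_ (hint.const_mul (K ^ 2)) ?_
    · refine (ae_restrict_iff' measurableSet_Ioi).2 (Filter.Eventually.of_forall fun t ht => ?_)
      have ht : 0 < t := ht
      simp only [Pi.zero_apply]
      positivity
    · refine (ae_restrict_iff' measurableSet_Ioi).2 (Filter.Eventually.of_forall fun t ht => ?_)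
      have ht : 0 < t := ht
      have hpow : ((1 / (t ^ 2 + ‖x - y‖ ^ 2)) ^ (((n : ℝ) + 2) / 2)) ^ 2 =
          ((t ^ 2 + ‖x - y‖ ^ 2) ^ (n + 2))⁻¹ := by
        rw [← rpow_mul_natCast (by positivity), one_div, ← inv_pow,
          ← rpow_natCast (t ^ 2 + ‖x - y‖ ^ 2)⁻¹ (n + 2)]
        congr 1
        push_cast
        ring
      have hsq : Omj n α j x y s t ^ 2 ≤
          K ^ 2 * t ^ 2 * ((t ^ 2 + ‖x - y‖ ^ 2) ^ (n + 2))⁻¹ := by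
        rw [← hpow, ← mul_pow, ← mul_pow, ← sq_abs]
        gcongr
        exact hKΩ x y s t hxy hs ht
      dsimp only
      rw [div_le_iff₀ ht]
      refine hsq.trans_eq ?_
      ring
  rw [integral_const_mul, hval] at hle
  refine sqrt_le_iff.2 ⟨by positivity, hle.trans ?_⟩
  rw [div_pow, div_eq_mul_inv (K ^ 2)]
  gcongr
  refine div_le_self (by positivity) ?_
  have : (0 : ℝ) ≤ n := n.cast_nonneg
  linarith
end

section
/- Let n ≥ 1 and α > -n. There exists a constant C > 0 such that for all x ∈ ℝⁿ and all z > 0, |d_z^α(x)| ≤ C / (ρ(x)^{1/2} z^{3/4}), and consequently |g_α(x,t)| ≤ C (t/ρ(x))^{1/2} for all x ∈ ℝⁿ and t > 0. -/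
open Real MeasureTheory Set

/-- The critical radius function ρ for the Hermite operator. -/
noncomputable def rho (n : ℕ) (x : EuclideanSpace ℝ (Fin n)) : ℝ :=
  if 1 ≤ ‖x‖ then 1 / (1 + ‖x‖) else 1 / 2

/-- The Hermite heat semigroup applied to the constant function 1. -/
noncomputable def w (n : ℕ) (z : ℝ) (x : EuclideanSpace ℝ (Fin n)) : ℝ :=
  Real.pi ^ (-(n : ℝ) / 2) * (Real.exp (-2 * z) / (1 + Real.exp (-4 * z))) ^ ((n : ℝ) / 2) *
    Real.exp (-((1 - Real.exp (-4 * z)) / (2 * (1 + Real.exp (-4 * z)))) * ‖x‖ ^ 2)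

/-- d_z^α(x) = ∂_z (e^{-αz} w_z(x)). -/
noncomputable def dk (n : ℕ) (α : ℝ) (z : ℝ) (x : EuclideanSpace ℝ (Fin n)) : ℝ :=
  -Real.exp (-α * z) * (α + n * (1 - Real.exp (-4 * z)) / (1 + Real.exp (-4 * z)) +
    4 * ‖x‖ ^ 2 * Real.exp (-4 * z) / (1 + Real.exp (-4 * z)) ^ 2) * w n z x

/-- g_α(x,t) = t ∂_t applied to the shifted Hermite-Poisson semigroup acting on 1. -/
noncomputable def gLP (n : ℕ) (α : ℝ) (x : EuclideanSpace ℝ (Fin n)) (t : ℝ) : ℝ :=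
  t ^ 2 / Real.sqrt (4 * Real.pi) *
    ∫ u in Set.Ioi (0 : ℝ), u ^ (-(3 : ℝ) / 2) * Real.exp (-u) * dk n α (t ^ 2 / (4 * u)) x

lemma rpow_three_quarters_le_one_add {v : ℝ} (hv : 0 ≤ v) : v ^ ((3 : ℝ) / 4) ≤ 1 + v := by
  calc v ^ ((3 : ℝ) / 4) ≤ (1 + v) ^ ((3 : ℝ) / 4) := by gcongr; linarith
    _ ≤ (1 + v) ^ (1 : ℝ) := rpow_le_rpow_of_exponent_le (by linarith) (by norm_num)
    _ = 1 + v := rpow_one _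

lemma rho_pos (n : ℕ) (x : EuclideanSpace ℝ (Fin n)) : 0 < rho n x := by
  unfold rho
  split_ifs <;> positivity

lemma rho_le_one (n : ℕ) (x : EuclideanSpace ℝ (Fin n)) : rho n x ≤ 1 := by
  unfold rho
  split_ifs
  · rw [div_le_one (by positivity)]
    linarith [norm_nonneg x]
  · norm_num

lemma rho_mul_norm_le_one (n : ℕ) (x : EuclideanSpace ℝ (Fin n)) : rho n x * ‖x‖ ≤ 1 := by
  unfold rho
  split_ifs
  · rw [one_div, inv_mul_le_one₀ (by positivity)]
    linarith
  · linarith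

/-- Heat kernel mass bound: the exponential decay `e^{-nz}` together with a Gaussian factor. -/
lemma w_le (n : ℕ) {z : ℝ} (hz : 0 < z) (x : EuclideanSpace ℝ (Fin n)) :
    w n z x ≤ exp (-(n : ℝ) * z) * exp (-((1 - exp (-4 * z)) * ‖x‖ ^ 2 / 4)) := by
  have he : exp (-4 * z) ≤ 1 := exp_le_one_iff.2 (by linarith)
  have he0 := exp_pos (-4 * z)
  have h1 : π ^ (-(n : ℝ) / 2) ≤ 1 :=
    rpow_le_one_of_one_le_of_nonpos (by linarith [pi_gt_three])
      (by have : (0 : ℝ) ≤ n := n.cast_nonneg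
          linarith)
  have h2 : (exp (-2 * z) / (1 + exp (-4 * z))) ^ ((n : ℝ) / 2) ≤ exp (-(n : ℝ) * z) := by
    calc (exp (-2 * z) / (1 + exp (-4 * z))) ^ ((n : ℝ) / 2)
        ≤ exp (-2 * z) ^ ((n : ℝ) / 2) := by
          gcongr
          exact div_le_self (exp_pos _).le (by linarith)
      _ = exp (-(n : ℝ) * z) := by rw [← exp_mul]; ring_nf
  have h3 : exp (-((1 - exp (-4 * z)) / (2 * (1 + exp (-4 * z)))) * ‖x‖ ^ 2)
      ≤ exp (-((1 - exp (-4 * z)) * ‖x‖ ^ 2 / 4)) := by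
    have : (1 - exp (-4 * z)) / 4 ≤ (1 - exp (-4 * z)) / (2 * (1 + exp (-4 * z))) :=
      div_le_div_of_nonneg_left (by linarith) (by positivity) (by linarith)
    apply exp_le_exp.2
    nlinarith [sq_nonneg ‖x‖]
  unfold w
  calc _ ≤ 1 * exp (-(n : ℝ) * z) * exp (-((1 - exp (-4 * z)) * ‖x‖ ^ 2 / 4)) := by gcongr
    _ = _ := by ring

lemma rpow_mul_exp_neg_le {a z : ℝ} (ha : 0 < a) (hz : 0 < z) :
    z ^ ((3 : ℝ) / 4) * exp (-a * z) ≤ (a ^ ((3 : ℝ) / 4))⁻¹ := by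
  have h : a ^ ((3 : ℝ) / 4) * z ^ ((3 : ℝ) / 4) ≤ exp (a * z) := by
    rw [← mul_rpow ha.le hz.le]
    linarith [rpow_three_quarters_le_one_add (mul_pos ha hz).le, add_one_le_exp (a * z)]
  have hp : 0 < a ^ ((3 : ℝ) / 4) := by positivity
  rw [le_inv_comm₀ (by positivity) hp, neg_mul, exp_neg, mul_inv, inv_inv, inv_mul_eq_div,
    le_div_iff₀ (by positivity)]
  exact h

/-- The quadratic term of `dk` gains a factor `z^{-3/4}` at the cost of `√r`. -/
lemma rpow_mul_sq_mul_gaussian_le {z r : ℝ} (hz : 0 < z) (hr : 0 ≤ r) :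
    z ^ ((3 : ℝ) / 4) * (r ^ 2 * exp (-4 * z) * exp (-((1 - exp (-4 * z)) * r ^ 2 / 4)))
      ≤ 4 * √r := by
  have he : exp (-4 * z) ≤ 1 := exp_le_one_iff.2 (by linarith)
  set s := 1 - exp (-4 * z) with hs
  have hs0 : 0 ≤ s := by linarith
  have h1 : z * exp (-4 * z) ≤ s := by
    have h := add_one_le_exp (4 * z)
    have h2 : exp (4 * z) * exp (-4 * z) = 1 := by rw [← exp_add]; simp
    nlinarith [exp_pos (-4 * z), mul_pos hz (exp_pos (-4 * z))]
  have h2 : z ^ ((3 : ℝ) / 4) * exp (-4 * z) ≤ s ^ ((3 : ℝ) / 4) := by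
    calc z ^ ((3 : ℝ) / 4) * exp (-4 * z)
        ≤ z ^ ((3 : ℝ) / 4) * exp (-4 * z) ^ ((3 : ℝ) / 4) := by
          gcongr
          rw [← exp_mul]
          apply exp_le_exp.2
          linarith
      _ = (z * exp (-4 * z)) ^ ((3 : ℝ) / 4) := (mul_rpow hz.le (exp_pos _).le).symm
      _ ≤ s ^ ((3 : ℝ) / 4) := by gcongr
  have h3 : (s * r ^ 2) ^ ((3 : ℝ) / 4) * exp (-(s * r ^ 2 / 4)) ≤ 4 := by
    rw [exp_neg, ← div_eq_mul_inv, div_le_iff₀ (exp_pos _)]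
    have hv : 0 ≤ s * r ^ 2 := by positivity
    linarith [rpow_three_quarters_le_one_add hv, add_one_le_exp (s * r ^ 2 / 4)]
  have h4 : r ^ 2 = (r ^ 2) ^ ((3 : ℝ) / 4) * √r := by
    rw [sqrt_eq_rpow, ← rpow_natCast r 2, ← rpow_mul hr, ← rpow_add_of_nonneg hr] <;> norm_num
  calc z ^ ((3 : ℝ) / 4) * (r ^ 2 * exp (-4 * z) * exp (-(s * r ^ 2 / 4)))
      = (z ^ ((3 : ℝ) / 4) * exp (-4 * z)) * (r ^ 2) * exp (-(s * r ^ 2 / 4)) := by ring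
    _ ≤ s ^ ((3 : ℝ) / 4) * (r ^ 2) * exp (-(s * r ^ 2 / 4)) := by gcongr
    _ = ((s * r ^ 2) ^ ((3 : ℝ) / 4) * exp (-(s * r ^ 2 / 4))) * √r := by
        rw [mul_rpow hs0 (by positivity)]
        linear_combination (s ^ ((3 : ℝ) / 4) * exp (-(s * r ^ 2 / 4))) * h4
    _ ≤ 4 * √r := by gcongr

lemma abs_dk_le (n : ℕ) (α : ℝ) (hα : -(n : ℝ) < α) (x : EuclideanSpace ℝ (Fin n)) {z : ℝ}
    (hz : 0 < z) :
    |dk n α z x| ≤ ((|α| + n) * ((α + n) ^ ((3 : ℝ) / 4))⁻¹ + 16) /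
      (√(rho n x) * z ^ ((3 : ℝ) / 4)) := by
  have he : exp (-4 * z) ≤ 1 := exp_le_one_iff.2 (by linarith)
  have he0 := exp_pos (-4 * z)
  have ha : 0 < α + n := by linarith
  have hw0 : 0 ≤ w n z x := by unfold w; positivity
  have hn0 : (0 : ℝ) ≤ n := n.cast_nonneg
  set G := exp (-((1 - exp (-4 * z)) * ‖x‖ ^ 2 / 4)) with hG
  have hG0 : 0 < G := exp_pos _
  have hG1 : G ≤ 1 := exp_le_one_iff.2 (by nlinarith [sq_nonneg ‖x‖])
  have hbr : |α + n * (1 - exp (-4 * z)) / (1 + exp (-4 * z)) +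
      4 * ‖x‖ ^ 2 * exp (-4 * z) / (1 + exp (-4 * z)) ^ 2|
      ≤ |α| + n + 4 * (‖x‖ ^ 2 * exp (-4 * z)) := by
    have hb0 : 0 ≤ n * (1 - exp (-4 * z)) / (1 + exp (-4 * z)) :=
      div_nonneg (mul_nonneg hn0 (by linarith)) (by linarith)
    have hb : n * (1 - exp (-4 * z)) / (1 + exp (-4 * z)) ≤ n := by
      rw [div_le_iff₀ (by positivity)]
      nlinarith
    have hc0 : 0 ≤ 4 * ‖x‖ ^ 2 * exp (-4 * z) / (1 + exp (-4 * z)) ^ 2 := by positivity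
    have hc : 4 * ‖x‖ ^ 2 * exp (-4 * z) / (1 + exp (-4 * z)) ^ 2
        ≤ 4 * ‖x‖ ^ 2 * exp (-4 * z) :=
      div_le_self (by positivity) (by nlinarith)
    refine (abs_add_three _ _ _).trans ?_
    rw [abs_of_nonneg hb0, abs_of_nonneg hc0]
    linarith
  have hdk : |dk n α z x| ≤
      (|α| + n + 4 * (‖x‖ ^ 2 * exp (-4 * z))) * (exp (-(α + n) * z) * G) := by
    unfold dk
    rw [abs_mul, abs_mul, abs_neg, abs_of_pos (exp_pos _), abs_of_nonneg hw0]
    calc _ ≤ exp (-α * z) * (|α| + n + 4 * (‖x‖ ^ 2 * exp (-4 * z))) *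
          (exp (-(n : ℝ) * z) * G) := by
            gcongr
            exact w_le n hz x
      _ = _ := by
        rw [show -(α + n) * z = -α * z + -(n : ℝ) * z by ring, exp_add]
        ring
  have hE1 : exp (-(α + n) * z) ≤ 1 := exp_le_one_iff.2 (by nlinarith)
  have hr0 := rho_pos n x
  have hs1 : √(rho n x) ≤ 1 := sqrt_le_one.2 (rho_le_one n x)
  have hs2 : √(rho n x) * √‖x‖ ≤ 1 := by
    rw [← sqrt_mul hr0.le]
    exact sqrt_le_one.2 (rho_mul_norm_le_one n x)
  have hA := rpow_mul_exp_neg_le ha hz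
  have hB := rpow_mul_sq_mul_gaussian_le hz (norm_nonneg x)
  rw [← hG] at hB
  set E := exp (-(α + n) * z)
  set Z := z ^ ((3 : ℝ) / 4)
  have hE0 : 0 < E := exp_pos _
  have hZ0 : 0 < Z := by positivity
  rw [le_div_iff₀ (by positivity)]
  calc |dk n α z x| * (√(rho n x) * Z)
      ≤ (|α| + n + 4 * (‖x‖ ^ 2 * exp (-4 * z))) * (E * G) * (√(rho n x) * Z) := by gcongr
    _ = (|α| + n) * (Z * E) * G * √(rho n x) +
          4 * (Z * (‖x‖ ^ 2 * exp (-4 * z) * G)) * E * √(rho n x) := by ring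
    _ ≤ (|α| + n) * ((α + n) ^ ((3 : ℝ) / 4))⁻¹ * 1 * 1 +
          4 * (4 * √‖x‖) * 1 * √(rho n x) := by gcongr
    _ = (|α| + n) * ((α + n) ^ ((3 : ℝ) / 4))⁻¹ + 16 * (√(rho n x) * √‖x‖) := by ring
    _ ≤ _ := by linarith

lemma abs_gLP_le (n : ℕ) (α K : ℝ) (x : EuclideanSpace ℝ (Fin n))
    (hK : ∀ z : ℝ, 0 < z → |dk n α z x| ≤ K / (√(rho n x) * z ^ ((3 : ℝ) / 4)))
    {t : ℝ} (ht : 0 < t) :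
    |gLP n α x t| ≤ K * (4 ^ ((3 : ℝ) / 4) / √(4 * π) * Gamma (1 / 4)) * √(t / rho n x) := by
  have hr0 := rho_pos n x
  set c := K * 4 ^ ((3 : ℝ) / 4) / (√(rho n x) * (t ^ 2) ^ ((3 : ℝ) / 4)) with hc
  have hint : IntegrableOn (fun u : ℝ => c * (exp (-u) * u ^ ((1 : ℝ) / 4 - 1))) (Ioi 0) :=
    (GammaIntegral_convergent (by norm_num)).const_mul c
  have hbound : ‖∫ u in Ioi (0 : ℝ), u ^ (-(3 : ℝ) / 2) * exp (-u) * dk n α (t ^ 2 / (4 * u)) x‖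
      ≤ ∫ u in Ioi (0 : ℝ), c * (exp (-u) * u ^ ((1 : ℝ) / 4 - 1)) := by
    refine norm_integral_le_of_norm_le hint ?_
    filter_upwards [ae_restrict_mem measurableSet_Ioi] with u hu
    have hu : 0 < u := hu
    have hp : u ^ ((1 : ℝ) / 4 - 1) = u ^ (-(3 : ℝ) / 2) * u ^ ((3 : ℝ) / 4) := by
      rw [← rpow_add hu]
      norm_num
    rw [norm_mul, norm_eq_abs, norm_eq_abs, abs_of_pos (by positivity)]
    calc _ ≤ u ^ (-(3 : ℝ) / 2) * exp (-u) *
          (K / (√(rho n x) * (t ^ 2 / (4 * u)) ^ ((3 : ℝ) / 4))) := by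
            gcongr
            exact hK _ (by positivity)
      _ = _ := by
        rw [hp, hc, div_rpow (by positivity) (by positivity), mul_rpow (by norm_num) hu.le]
        field_simp
  rw [integral_const_mul, ← Gamma_eq_integral (by norm_num), norm_eq_abs] at hbound
  have ht2 : t ^ 2 = (t ^ 2) ^ ((3 : ℝ) / 4) * √t := by
    rw [sqrt_eq_rpow, ← rpow_natCast t 2, ← rpow_mul ht.le, ← rpow_add ht]
    norm_num
  unfold gLP
  rw [abs_mul, abs_of_pos (by positivity), sqrt_div ht.le]
  calc _ ≤ t ^ 2 / √(4 * π) * (c * Gamma (1 / 4)) := by gcongr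
    _ = (t ^ 2 / (t ^ 2) ^ ((3 : ℝ) / 4)) *
          (K * (4 ^ ((3 : ℝ) / 4) / √(4 * π) * Gamma (1 / 4)) / √(rho n x)) := by
        rw [hc]
        field_simp
    _ = √t * (K * (4 ^ ((3 : ℝ) / 4) / √(4 * π) * Gamma (1 / 4)) / √(rho n x)) := by
        congr 1
        rw [div_eq_iff (by positivity), mul_comm]
        exact ht2
    _ = _ := by ring

theorem dk_and_g_bound (n : ℕ) (hn : 1 ≤ n) (α : ℝ) (hα : -(n : ℝ) < α) :
    ∃ C > (0 : ℝ),
      (∀ (x : EuclideanSpace ℝ (Fin n)) (z : ℝ), 0 < z →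
        |dk n α z x| ≤ C / (Real.sqrt (rho n x) * z ^ ((3 : ℝ) / 4))) ∧
      (∀ (x : EuclideanSpace ℝ (Fin n)) (t : ℝ), 0 < t →
        |gLP n α x t| ≤ C * Real.sqrt (t / rho n x)) := by
  have ha : 0 < α + n := by linarith
  set K := (|α| + n) * ((α + n) ^ ((3 : ℝ) / 4))⁻¹ + 16
  have hK : 0 < K := by positivity
  set B := 4 ^ ((3 : ℝ) / 4) / √(4 * π) * Gamma (1 / 4)
  have hB : 0 < B := mul_pos (by positivity) (Gamma_pos_of_pos (by norm_num))
  refine ⟨K * (1 + B), by positivity, fun x z hz => ?_, fun x t ht => ?_⟩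
  · have hr0 := rho_pos n x
    refine (abs_dk_le n α hα x hz).trans ?_
    gcongr
    nlinarith
  · refine (abs_gLP_le n α K x (fun z hz => abs_dk_le n α hα x hz) ht).trans ?_
    gcongr
    linarith
end
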